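/- arXiv:0906.1215 — 2 statements merged into one kernel-verified Lean document; each statement's English description precedes it below -/
import Mathlib

section
/- Let c₁, c₂, c̄₁, c̄₂ ∈ ℂ, and let 𝖠₁, 𝖠₂ be elements of a unital associative ℂ-algebra B satisfying the simply-linked generalized q-Onsager relations 𝖠_i²𝖠_j − (q + q⁻¹) 𝖠_i𝖠_j𝖠_i + 𝖠_j𝖠_i² = c_i c̄_i 𝖠_j for both (i,j) = (1,2) and (i,j) = (2,1). Then in the tensor product algebra A ⊗_ℂ B the elements D_i = (c_i e_i K_i + c̄_i f_i K_i) ⊗ 1 + K_i² ⊗ 𝖠_i (i = 1,2), given by the coaction map, satisfy the same relations: D_i²D_j − (q + q⁻¹) D_iD_jD_i + D_jD_i² = c_i c̄_i D_j for both (i,j) = (1,2) and (i,j) = (2,1). -/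
open TensorProduct

/-- The `U_q` relations of a simply-linked pair of nodes that involve `K₁` and `L₁ = K₁⁻¹`, the
commutator `[e₁, f₁]` and the Serre relations quadratic in the first node, with the Cartan elements
moved to the right. -/
structure SimplyLinkedRelations {A : Type*} [Ring A] [Algebra ℂ A] (s : ℂ)
    (e₁ e₂ f₁ f₂ K₁ L₁ K₂ : A) : Prop where
  L_mul_K : L₁ * K₁ = 1
  K_comm : K₂ * K₁ = K₁ * K₂
  K₁_e₁ : K₁ * e₁ = s ^ 2 • (e₁ * K₁)
  K₁_f₁ : K₁ * f₁ = (s ^ 2)⁻¹ • (f₁ * K₁)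
  K₁_e₂ : K₁ * e₂ = s⁻¹ • (e₂ * K₁)
  K₁_f₂ : K₁ * f₂ = s • (f₂ * K₁)
  K₂_e₁ : K₂ * e₁ = s⁻¹ • (e₁ * K₂)
  K₂_f₁ : K₂ * f₁ = s • (f₁ * K₂)
  L₁_e₂ : L₁ * e₂ = s • (e₂ * L₁)
  e₁_f₁ : e₁ * f₁ = f₁ * e₁ + (s ^ 2 / (s ^ 4 - 1)) • (K₁ * K₁ - L₁ * L₁)
  e₁_f₂ : e₁ * f₂ = f₂ * e₁
  e₂_f₁ : e₂ * f₁ = f₁ * e₂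
  serre_e : e₁ * (e₁ * e₂) = (s ^ 2 + (s ^ 2)⁻¹) • (e₁ * (e₂ * e₁)) - e₂ * (e₁ * e₁)
  serre_f : f₁ * (f₁ * f₂) = (s ^ 2 + (s ^ 2)⁻¹) • (f₁ * (f₂ * f₁)) - f₂ * (f₁ * f₁)

theorem mul_left_of_mul_eq {M : Type*} [Semigroup M] {a b c : M} (h : a * b = c) (x : M) :
    a * (b * x) = c * x := by
  rw [← mul_assoc, h]

theorem Units.mul_eq_smul_mul_of_conj {A : Type*} [Ring A] [Algebra ℂ A] {K : Aˣ} {x : A} {t : ℂ}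
    (h : (K : A) * x * ((K⁻¹ : Aˣ) : A) = t • x) : (K : A) * x = t • (x * K) := by
  rw [← smul_mul_assoc, ← h, Units.inv_mul_cancel_right]

theorem Units.inv_mul_eq_smul_mul_of_conj {A : Type*} [Ring A] [Algebra ℂ A] {K : Aˣ} {x : A}
    {t : ℂ} (ht : t ≠ 0) (h : (K : A) * x * ((K⁻¹ : Aˣ) : A) = t • x) :
    ((K⁻¹ : Aˣ) : A) * x = t⁻¹ • (x * ((K⁻¹ : Aˣ) : A)) := by
  rw [eq_inv_smul_iff₀ ht, ← mul_smul_comm, ← h, mul_assoc,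
    Units.inv_mul_cancel_left]

namespace SimplyLinkedRelations

variable {A : Type*} [Ring A] [Algebra ℂ A] {s : ℂ} {e₁ e₂ f₁ f₂ K₁ L₁ K₂ : A}

theorem of_units {K₁ K₂ : Aˣ} (hs : s ≠ 0)
    (hK : (K₁ : A) * (K₂ : A) = (K₂ : A) * (K₁ : A))
    (hK₁e₁ : (K₁ : A) * e₁ * ((K₁⁻¹ : Aˣ) : A) = s ^ 2 • e₁)
    (hK₁f₁ : (K₁ : A) * f₁ * ((K₁⁻¹ : Aˣ) : A) = (s ^ 2)⁻¹ • f₁)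
    (hK₁e₂ : (K₁ : A) * e₂ * ((K₁⁻¹ : Aˣ) : A) = s⁻¹ • e₂)
    (hK₁f₂ : (K₁ : A) * f₂ * ((K₁⁻¹ : Aˣ) : A) = s • f₂)
    (hK₂e₁ : (K₂ : A) * e₁ * ((K₂⁻¹ : Aˣ) : A) = s⁻¹ • e₁)
    (hK₂f₁ : (K₂ : A) * f₁ * ((K₂⁻¹ : Aˣ) : A) = s • f₁)
    (hef : e₁ * f₁ - f₁ * e₁ =
      (s ^ 2 - (s ^ 2)⁻¹)⁻¹ • ((K₁ : A) ^ 2 - ((K₁⁻¹ : Aˣ) : A) ^ 2))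
    (hef₁₂ : e₁ * f₂ = f₂ * e₁) (hef₂₁ : e₂ * f₁ = f₁ * e₂)
    (hSe : e₁ ^ 2 * e₂ - (s ^ 2 + (s ^ 2)⁻¹) • (e₁ * e₂ * e₁) + e₂ * e₁ ^ 2 = 0)
    (hSf : f₁ ^ 2 * f₂ - (s ^ 2 + (s ^ 2)⁻¹) • (f₁ * f₂ * f₁) + f₂ * f₁ ^ 2 = 0) :
    SimplyLinkedRelations s e₁ e₂ f₁ f₂ (K₁ : A) ((K₁⁻¹ : Aˣ) : A) (K₂ : A) where
  L_mul_K := K₁.inv_mul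
  K_comm := hK.symm
  K₁_e₁ := Units.mul_eq_smul_mul_of_conj hK₁e₁
  K₁_f₁ := Units.mul_eq_smul_mul_of_conj hK₁f₁
  K₁_e₂ := Units.mul_eq_smul_mul_of_conj hK₁e₂
  K₁_f₂ := Units.mul_eq_smul_mul_of_conj hK₁f₂
  K₂_e₁ := Units.mul_eq_smul_mul_of_conj hK₂e₁
  K₂_f₁ := Units.mul_eq_smul_mul_of_conj hK₂f₁
  L₁_e₂ := by simpa using Units.inv_mul_eq_smul_mul_of_conj (inv_ne_zero hs) hK₁e₂
  e₁_f₁ := by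
    have hcoef : (s ^ 2 - (s ^ 2)⁻¹)⁻¹ = s ^ 2 / (s ^ 4 - 1) := by
      rw [inv_eq_iff_eq_inv, inv_div]
      field_simp
    rw [← hcoef, ← pow_two, ← pow_two, ← hef, add_sub_cancel]
  e₁_f₂ := hef₁₂
  e₂_f₁ := hef₂₁
  serre_e := by
    rw [← sub_eq_zero, ← hSe]
    simp only [pow_two e₁, mul_assoc]
    abel
  serre_f := by
    rw [← sub_eq_zero, ← hSf]
    simp only [pow_two f₁, mul_assoc]
    abel

theorem qSerre_sq_sq_vector (h : SimplyLinkedRelations s e₁ e₂ f₁ f₂ K₁ L₁ K₂) (hs : s ≠ 0)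
    (d db : ℂ) (k Y : A) (hk : k = K₁ ^ 2) (hY : Y = d • (e₂ * K₂) + db • (f₂ * K₂)) :
    k * k * Y - (s ^ 2 + (s ^ 2)⁻¹) • (k * Y * k) + Y * (k * k) = 0 := by
  subst hk hY
  simp only [pow_two K₁, mul_add, add_mul, mul_assoc, smul_mul_assoc, mul_smul_comm, smul_add,
    smul_smul, h.K_comm, mul_left_of_mul_eq h.K_comm, mul_left_of_mul_eq h.K₁_e₂,
    mul_left_of_mul_eq h.K₁_f₂]
  match_scalars <;> field_simp <;> ring

theorem qSerre_vector_sq_vector (h : SimplyLinkedRelations s e₁ e₂ f₁ f₂ K₁ L₁ K₂) (hs : s ≠ 0)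
    (c cb d db : ℂ) (X k Y : A) (hX : X = c • (e₁ * K₁) + cb • (f₁ * K₁)) (hk : k = K₁ ^ 2)
    (hY : Y = d • (e₂ * K₂) + db • (f₂ * K₂)) :
    (X * k + k * X) * Y - (s ^ 2 + (s ^ 2)⁻¹) • (X * Y * k + k * Y * X) +
      Y * (X * k + k * X) = 0 := by
  subst hX hk hY
  simp only [pow_two K₁, mul_add, add_mul, mul_assoc, smul_mul_assoc, mul_smul_comm, smul_add,
    smul_smul, h.K_comm, mul_left_of_mul_eq h.K_comm, mul_left_of_mul_eq h.K₁_e₂,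
    mul_left_of_mul_eq h.K₁_f₂, mul_left_of_mul_eq h.K₁_e₁, mul_left_of_mul_eq h.K₁_f₁,
    mul_left_of_mul_eq h.K₂_e₁, mul_left_of_mul_eq h.K₂_f₁, mul_left_of_mul_eq h.e₂_f₁,
    mul_left_of_mul_eq h.e₁_f₂]
  match_scalars <;> field_simp <;> ring

theorem qSerre_vector_vector_sq (h : SimplyLinkedRelations s e₁ e₂ f₁ f₂ K₁ L₁ K₂) (hs : s ≠ 0)
    (hs4 : s ^ 4 - 1 ≠ 0)
    (c cb : ℂ) (X k l : A) (hX : X = c • (e₁ * K₁) + cb • (f₁ * K₁)) (hk : k = K₁ ^ 2)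
    (hl : l = K₂ ^ 2) :
    X * X * l - (s ^ 2 + (s ^ 2)⁻¹) • (X * l * X) + l * (X * X) = (c * cb) • (l - k * k * l) := by
  subst hX hk hl
  simp only [pow_two K₁, pow_two K₂, mul_add, add_mul, mul_sub, sub_mul, mul_assoc, smul_mul_assoc,
    mul_smul_comm, smul_add, smul_sub, smul_smul, h.K_comm, mul_left_of_mul_eq h.K_comm,
    mul_left_of_mul_eq h.L_mul_K, h.L_mul_K, one_mul, mul_one, mul_left_of_mul_eq h.K₁_e₁,
    mul_left_of_mul_eq h.K₁_f₁, mul_left_of_mul_eq h.K₂_e₁, mul_left_of_mul_eq h.K₂_f₁,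
    mul_left_of_mul_eq h.e₁_f₁]
  match_scalars <;> field_simp <;> ring

theorem qSerre_vector_sq_sq (h : SimplyLinkedRelations s e₁ e₂ f₁ f₂ K₁ L₁ K₂) (hs : s ≠ 0)
    (c cb : ℂ) (X k l : A) (hX : X = c • (e₁ * K₁) + cb • (f₁ * K₁)) (hk : k = K₁ ^ 2)
    (hl : l = K₂ ^ 2) :
    (X * k + k * X) * l - (s ^ 2 + (s ^ 2)⁻¹) • (k * l * X) = 0 ∧
      l * (X * k + k * X) - (s ^ 2 + (s ^ 2)⁻¹) • (X * l * k) = 0 := by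
  subst hX hk hl
  constructor <;>
  · simp only [pow_two K₁, pow_two K₂, mul_add, add_mul, mul_assoc, smul_mul_assoc, mul_smul_comm,
      smul_add, smul_smul, h.K_comm, mul_left_of_mul_eq h.K_comm, mul_left_of_mul_eq h.K₁_e₁,
      mul_left_of_mul_eq h.K₁_f₁, mul_left_of_mul_eq h.K₂_e₁, mul_left_of_mul_eq h.K₂_f₁]
    match_scalars <;> field_simp <;> ring

theorem qSerre_vector_vector_vector (h : SimplyLinkedRelations s e₁ e₂ f₁ f₂ K₁ L₁ K₂) (hs : s ≠ 0)
    (hs4 : s ^ 4 - 1 ≠ 0)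
    (c cb d db : ℂ) (X Y : A) (hX : X = c • (e₁ * K₁) + cb • (f₁ * K₁))
    (hY : Y = d • (e₂ * K₂) + db • (f₂ * K₂)) :
    X * X * Y - (s ^ 2 + (s ^ 2)⁻¹) • (X * Y * X) + Y * (X * X) = (c * cb) • Y := by
  subst hX hY
  have he (x : A) : e₁ * (e₁ * (e₂ * x)) =
      (s ^ 2 + (s ^ 2)⁻¹) • (e₁ * (e₂ * (e₁ * x))) - e₂ * (e₁ * (e₁ * x)) := by
    simpa only [mul_assoc, sub_mul, smul_mul_assoc] using congrArg (· * x) h.serre_e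
  have hf (x : A) : f₁ * (f₁ * (f₂ * x)) =
      (s ^ 2 + (s ^ 2)⁻¹) • (f₁ * (f₂ * (f₁ * x))) - f₂ * (f₁ * (f₁ * x)) := by
    simpa only [mul_assoc, sub_mul, smul_mul_assoc] using congrArg (· * x) h.serre_f
  simp only [mul_add, add_mul, mul_sub, sub_mul, mul_assoc, smul_mul_assoc, mul_smul_comm,
    smul_add, smul_sub, smul_smul, h.K_comm, mul_left_of_mul_eq h.K_comm,
    mul_left_of_mul_eq h.L_mul_K, h.L_mul_K, one_mul, mul_one, mul_left_of_mul_eq h.K₁_e₁,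
    mul_left_of_mul_eq h.K₁_f₁, mul_left_of_mul_eq h.K₁_e₂, mul_left_of_mul_eq h.K₁_f₂,
    mul_left_of_mul_eq h.L₁_e₂, mul_left_of_mul_eq h.K₂_e₁, mul_left_of_mul_eq h.K₂_f₁,
    mul_left_of_mul_eq h.e₁_f₁, mul_left_of_mul_eq h.e₂_f₁, mul_left_of_mul_eq h.e₁_f₂, he, hf]
  match_scalars <;> field_simp <;> ring

/-- One of the two generalized q-Onsager relations for the images of the coaction map. -/
theorem qOnsager_coaction (h : SimplyLinkedRelations s e₁ e₂ f₁ f₂ K₁ L₁ K₂) (hs : s ≠ 0)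
    (hs4 : s ^ 4 - 1 ≠ 0) {B : Type*} [Ring B] [Algebra ℂ B] (c cb d db : ℂ) (a b : B)
    (hab : a ^ 2 * b - (s ^ 2 + (s ^ 2)⁻¹) • (a * b * a) + b * a ^ 2 = (c * cb) • b)
    (D₁ D₂ : A ⊗[ℂ] B)
    (hD₁ : D₁ = (c • (e₁ * K₁) + cb • (f₁ * K₁)) ⊗ₜ[ℂ] (1 : B) + (K₁ ^ 2) ⊗ₜ[ℂ] a)
    (hD₂ : D₂ = (d • (e₂ * K₂) + db • (f₂ * K₂)) ⊗ₜ[ℂ] (1 : B) + (K₂ ^ 2) ⊗ₜ[ℂ] b) :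
    D₁ ^ 2 * D₂ - (s ^ 2 + (s ^ 2)⁻¹) • (D₁ * D₂ * D₁) + D₂ * D₁ ^ 2 = (c * cb) • D₂ := by
  generalize hX : c • (e₁ * K₁) + cb • (f₁ * K₁) = X at hD₁
  generalize hY : d • (e₂ * K₂) + db • (f₂ * K₂) = Y at hD₂
  have hkl : K₂ ^ 2 * K₁ ^ 2 = K₁ ^ 2 * K₂ ^ 2 := (show Commute K₂ K₁ from h.K_comm).pow_pow 2 2
  generalize hk : K₁ ^ 2 = k at hD₁ hkl
  generalize hl : K₂ ^ 2 = l at hD₂ hkl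
  have hXXY := h.qSerre_vector_vector_vector hs hs4 c cb d db X Y hX.symm hY.symm
  have hXXl := h.qSerre_vector_vector_sq hs hs4 c cb X k l hX.symm hk.symm hl.symm
  have hXkY := h.qSerre_vector_sq_vector hs c cb d db X k Y hX.symm hk.symm hY.symm
  have hkkY := h.qSerre_sq_sq_vector hs d db k Y hk.symm hY.symm
  obtain ⟨hkl_right, hkl_left⟩ := h.qSerre_vector_sq_sq hs c cb X k l hX.symm hk.symm hl.symm
  have hklk : k * l * k = k * k * l := by rw [mul_assoc, hkl, mul_assoc]
  have hlkk : l * (k * k) = k * k * l := by rw [← mul_assoc, hkl, hklk]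
  generalize s ^ 2 + (s ^ 2)⁻¹ = p at *
  have expand : D₁ ^ 2 * D₂ - p • (D₁ * D₂ * D₁) + D₂ * D₁ ^ 2 =
      (X * X * Y - p • (X * Y * X) + Y * (X * X)) ⊗ₜ[ℂ] (1 : B)
      + (X * X * l - p • (X * l * X) + l * (X * X)) ⊗ₜ[ℂ] b
      + ((X * k + k * X) * Y - p • (X * Y * k + k * Y * X) + Y * (X * k + k * X)) ⊗ₜ[ℂ] a
      + (k * k * Y - p • (k * Y * k) + Y * (k * k)) ⊗ₜ[ℂ] (a * a)
      + ((X * k + k * X) * l - p • (k * l * X)) ⊗ₜ[ℂ] (a * b)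
      + (l * (X * k + k * X) - p • (X * l * k)) ⊗ₜ[ℂ] (b * a)
      + (k * k * l) ⊗ₜ[ℂ] (a ^ 2 * b - p • (a * b * a) + b * a ^ 2) := by
    have honsager : (k * k * l) ⊗ₜ[ℂ] (a ^ 2 * b - p • (a * b * a) + b * a ^ 2) =
        (k * k * l) ⊗ₜ[ℂ] (a ^ 2 * b) - p • (k * l * k) ⊗ₜ[ℂ] (a * b * a)
        + (l * (k * k)) ⊗ₜ[ℂ] (b * a ^ 2) := by
      rw [hklk, hlkk, tmul_add, tmul_sub, tmul_smul]
    rw [honsager, hD₁, hD₂]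
    simp only [pow_two, mul_add, add_mul, Algebra.TensorProduct.tmul_mul_tmul, one_mul, mul_one,
      add_tmul, sub_tmul, smul_add, ← smul_tmul', mul_assoc]
    module
  rw [expand, hXXY, hXXl, hXkY, hkkY, hkl_right, hkl_left, hab, hD₂]
  simp only [zero_tmul, smul_tmul', tmul_smul, sub_tmul, smul_add, smul_sub]
  module

end SimplyLinkedRelations

/-- If `𝒜₁, 𝒜₂` satisfy the simply-linked generalized q-Onsager
relations, then the images `D_i = (c_i e_i K_i + c̄_i f_i K_i) ⊗ 1 + K_i² ⊗ 𝒜_i`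
under the coaction map satisfy the same relations in `A ⊗[ℂ] B`. -/
theorem stmt_8 (s : ℂ) (hs0 : s ≠ 0) (hsroot : ∀ n : ℕ, 0 < n → s ^ n ≠ 1)
    (q : ℂ) (hq : q = s ^ 2)
    (A : Type*) [Ring A] [Algebra ℂ A]
    (e₁ e₂ f₁ f₂ : A) (K₁ K₂ : Aˣ)
    (hKcomm : (K₁ : A) * (K₂ : A) = (K₂ : A) * (K₁ : A))
    (hK1e1 : (K₁ : A) * e₁ * ((K₁⁻¹ : Aˣ) : A) = q • e₁)
    (hK1f1 : (K₁ : A) * f₁ * ((K₁⁻¹ : Aˣ) : A) = q⁻¹ • f₁)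
    (hK2e2 : (K₂ : A) * e₂ * ((K₂⁻¹ : Aˣ) : A) = q • e₂)
    (hK2f2 : (K₂ : A) * f₂ * ((K₂⁻¹ : Aˣ) : A) = q⁻¹ • f₂)
    (hK1e2 : (K₁ : A) * e₂ * ((K₁⁻¹ : Aˣ) : A) = s⁻¹ • e₂)
    (hK1f2 : (K₁ : A) * f₂ * ((K₁⁻¹ : Aˣ) : A) = s • f₂)
    (hK2e1 : (K₂ : A) * e₁ * ((K₂⁻¹ : Aˣ) : A) = s⁻¹ • e₁)
    (hK2f1 : (K₂ : A) * f₁ * ((K₂⁻¹ : Aˣ) : A) = s • f₁)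
    (hef1 : e₁ * f₁ - f₁ * e₁ = (q - q⁻¹)⁻¹ • ((K₁ : A) ^ 2 - ((K₁⁻¹ : Aˣ) : A) ^ 2))
    (hef2 : e₂ * f₂ - f₂ * e₂ = (q - q⁻¹)⁻¹ • ((K₂ : A) ^ 2 - ((K₂⁻¹ : Aˣ) : A) ^ 2))
    (hef12 : e₁ * f₂ = f₂ * e₁) (hef21 : e₂ * f₁ = f₁ * e₂)
    (hSe12 : e₁ ^ 2 * e₂ - (q + q⁻¹) • (e₁ * e₂ * e₁) + e₂ * e₁ ^ 2 = 0)
    (hSe21 : e₂ ^ 2 * e₁ - (q + q⁻¹) • (e₂ * e₁ * e₂) + e₁ * e₂ ^ 2 = 0)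
    (hSf12 : f₁ ^ 2 * f₂ - (q + q⁻¹) • (f₁ * f₂ * f₁) + f₂ * f₁ ^ 2 = 0)
    (hSf21 : f₂ ^ 2 * f₁ - (q + q⁻¹) • (f₂ * f₁ * f₂) + f₁ * f₂ ^ 2 = 0)
    (B : Type*) [Ring B] [Algebra ℂ B]
    (c₁ c₂ cb₁ cb₂ : ℂ) (𝒜₁ 𝒜₂ : B)
    (hOns12 : 𝒜₁ ^ 2 * 𝒜₂ - (q + q⁻¹) • (𝒜₁ * 𝒜₂ * 𝒜₁) + 𝒜₂ * 𝒜₁ ^ 2 = (c₁ * cb₁) • 𝒜₂)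
    (hOns21 : 𝒜₂ ^ 2 * 𝒜₁ - (q + q⁻¹) • (𝒜₂ * 𝒜₁ * 𝒜₂) + 𝒜₁ * 𝒜₂ ^ 2 = (c₂ * cb₂) • 𝒜₁)
    (D₁ D₂ : A ⊗[ℂ] B)
    (hD1 : D₁ = (c₁ • (e₁ * (K₁ : A)) + cb₁ • (f₁ * (K₁ : A))) ⊗ₜ[ℂ] (1 : B)
      + ((K₁ : A) ^ 2) ⊗ₜ[ℂ] 𝒜₁)
    (hD2 : D₂ = (c₂ • (e₂ * (K₂ : A)) + cb₂ • (f₂ * (K₂ : A))) ⊗ₜ[ℂ] (1 : B)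
      + ((K₂ : A) ^ 2) ⊗ₜ[ℂ] 𝒜₂) :
    D₁ ^ 2 * D₂ - (q + q⁻¹) • (D₁ * D₂ * D₁) + D₂ * D₁ ^ 2 = (c₁ * cb₁) • D₂
    ∧ D₂ ^ 2 * D₁ - (q + q⁻¹) • (D₂ * D₁ * D₂) + D₁ * D₂ ^ 2 = (c₂ * cb₂) • D₁ := by
  have hs4 : s ^ 4 - 1 ≠ 0 := sub_ne_zero.mpr (hsroot 4 (by norm_num))
  subst hq
  have h12 : SimplyLinkedRelations s e₁ e₂ f₁ f₂ (K₁ : A) ((K₁⁻¹ : Aˣ) : A) (K₂ : A) :=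
    .of_units hs0 hKcomm hK1e1 hK1f1 hK1e2 hK1f2 hK2e1 hK2f1 hef1 hef12 hef21 hSe12 hSf12
  have h21 : SimplyLinkedRelations s e₂ e₁ f₂ f₁ (K₂ : A) ((K₂⁻¹ : Aˣ) : A) (K₁ : A) :=
    .of_units hs0 hKcomm.symm hK2e2 hK2f2 hK2e1 hK2f1 hK1e2 hK1f2 hef2 hef21 hef12 hSe21 hSf21
  exact ⟨h12.qOnsager_coaction hs0 hs4 c₁ cb₁ c₂ cb₂ 𝒜₁ 𝒜₂ hOns12 D₁ D₂ hD1 hD2,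
    h21.qOnsager_coaction hs0 hs4 c₂ cb₂ c₁ cb₁ 𝒜₂ 𝒜₁ hOns21 D₂ D₁ hD2 hD1⟩
end

section
/- Let c₁, c₂, c̄₁, c̄₂ ∈ ℂ, and let 𝖠₁, 𝖠₂ be elements of a unital associative ℂ-algebra B satisfying the doubly-linked generalized q-Onsager relations 𝖠₁²𝖠₂ − (q² + q⁻²) 𝖠₁𝖠₂𝖠₁ + 𝖠₂𝖠₁² = c₁c̄₁ 𝖠₂ and 𝖠₂³𝖠₁ − [3]_q 𝖠₂²𝖠₁𝖠₂ + [3]_q 𝖠₂𝖠₁𝖠₂² − 𝖠₁𝖠₂³ = c₂c̄₂ (q + q⁻¹)² (𝖠₂𝖠₁ − 𝖠₁𝖠₂). Then in the tensor product algebra A ⊗_ℂ B the elements D_i = (c_i e_i K_i + c̄_i f_i K_i) ⊗ 1 + K_i² ⊗ 𝖠_i (i = 1,2), given by the coaction map, satisfy the same two relations with the same constants. -/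
open TensorProduct

section QOnsager

theorem mul_mul_of_commute {R : Type*} [Ring R] {a b : R} (h : Commute a b) (x : R) : a * (b * x) = b * (a * x) := by
  rw [← mul_assoc, h.eq, mul_assoc]

variable {R : Type*} [Ring R] [Algebra ℂ R]

theorem mul_mul_of_mul_eq_smul {a b c : R} {t : ℂ} (h : a * b = t • (b * c)) (x : R) :
    a * (b * x) = t • (b * (c * x)) := by
  rw [← mul_assoc, h, smul_mul_assoc, mul_assoc]

theorem mul_mul_of_mul_eq_smul_add {E F N : R} {t u : ℂ}
    (h : E * F = t • (F * E) + u • (N - 1)) (x : R) :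
    E * (F * x) = t • (F * (E * x)) + u • (N * x - x) := by
  rw [← mul_assoc, h, add_mul, smul_mul_assoc, smul_mul_assoc, sub_mul, one_mul, mul_assoc]

/-- The quadratic relations among the summands `E ∝ eK`, `F ∝ fK`, `W = K² ⊗ 𝒜` of a coaction
image at a single node with parameter `s`, where `N = K⁴`. -/
structure IsCoactionTriple (s k : ℂ) (E F W N : R) : Prop where
  mul_EF : E * F = s⁻¹ ^ 2 • (F * E) + (s⁻¹ * k) • (N - 1)
  mul_WE : W * E = s ^ 2 • (E * W)
  mul_WF : W * F = s⁻¹ ^ 2 • (F * W)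
  mul_NE : N * E = s ^ 4 • (E * N)
  mul_NF : N * F = s⁻¹ ^ 4 • (F * N)
  commute_NW : Commute N W

namespace IsCoactionTriple

variable {s k : ℂ} {E F W N y : R}

theorem symm (h : IsCoactionTriple s k E F W N) (hs : s ≠ 0) :
    IsCoactionTriple s⁻¹ (-k) F E W N where
  mul_EF := by
    rw [h.mul_EF]
    match_scalars <;> field_simp <;> ring
  mul_WE := h.mul_WF
  mul_WF := by simpa using h.mul_WE
  mul_NE := h.mul_NF
  mul_NF := by simpa using h.mul_NE
  commute_NW := h.commute_NW

theorem cubic_root (h : IsCoactionTriple s k E F W N) (hs : s ≠ 0)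
    (hyF : y * F = s • (F * y)) (hWy : W * y = s⁻¹ • (y * W)) (hNy : N * y = s⁻¹ ^ 2 • (y * N))
    (hS : E ^ 2 * y - (s + s⁻¹) • (E * y * E) + y * E ^ 2 = 0) :
    (E + F + W) ^ 2 * y - (s + s⁻¹) • ((E + F + W) * y * (E + F + W)) + y * (E + F + W) ^ 2
      = (k * (s - s⁻¹)) • y := by
  rw [← sub_eq_zero, ← sub_eq_zero.mpr hS]
  simp only [pow_two (_ : R), mul_add, add_mul, mul_sub, sub_mul, mul_assoc, smul_mul_assoc,
    mul_smul_comm, mul_one, one_mul, h.mul_EF, h.mul_WE, h.mul_WF, hyF, hWy, hNy,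
    mul_mul_of_mul_eq_smul_add h.mul_EF, mul_mul_of_mul_eq_smul hyF, mul_mul_of_mul_eq_smul hWy]
  match_scalars <;> field_simp <;> ring

theorem cubic_cartan (h : IsCoactionTriple s k E F W N) (hs : s ≠ 0)
    (hyE : y * E = s⁻¹ • (E * y)) (hyF : y * F = s • (F * y)) (hyN : Commute y N)
    (hS : W ^ 2 * y - (s + s⁻¹) • (W * y * W) + y * W ^ 2 = (k * (s - s⁻¹)) • (N * y)) :
    (E + F + W) ^ 2 * y - (s + s⁻¹) • ((E + F + W) * y * (E + F + W)) + y * (E + F + W) ^ 2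
      = (k * (s - s⁻¹)) • y := by
  rw [← sub_eq_zero, ← sub_eq_zero.mpr hS]
  simp only [pow_two (_ : R), mul_add, add_mul, mul_sub, sub_mul, mul_assoc, smul_mul_assoc,
    mul_smul_comm, mul_one, one_mul, h.mul_EF, h.mul_WE, h.mul_WF, hyE, hyF, hyN.eq,
    mul_mul_of_mul_eq_smul_add h.mul_EF, mul_mul_of_mul_eq_smul h.mul_WE,
    mul_mul_of_mul_eq_smul h.mul_WF, mul_mul_of_mul_eq_smul hyF, mul_mul_of_mul_eq_smul hyE]
  match_scalars <;> field_simp <;> ring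

theorem quartic_root (h : IsCoactionTriple s k E F W N) (hs : s ≠ 0)
    (hyF : y * F = s ^ 2 • (F * y)) (hWy : W * y = s⁻¹ ^ 2 • (y * W))
    (hNy : N * y = s⁻¹ ^ 4 • (y * N))
    (hS : E ^ 3 * y - (s ^ 2 + 1 + (s ^ 2)⁻¹) • (E ^ 2 * y * E)
      + (s ^ 2 + 1 + (s ^ 2)⁻¹) • (E * y * E ^ 2) - y * E ^ 3 = 0) :
    (E + F + W) ^ 3 * y - (s ^ 2 + 1 + (s ^ 2)⁻¹) • ((E + F + W) ^ 2 * y * (E + F + W))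
      + (s ^ 2 + 1 + (s ^ 2)⁻¹) • ((E + F + W) * y * (E + F + W) ^ 2) - y * (E + F + W) ^ 3
      = (k * (s - s⁻¹) * (s + s⁻¹) ^ 2) • ((E + F + W) * y - y * (E + F + W)) := by
  rw [← sub_eq_zero, ← sub_eq_zero.mpr hS]
  simp only [pow_succ (_ : R), pow_zero (_ : R), mul_add, add_mul, mul_sub, sub_mul, mul_assoc,
    smul_mul_assoc, mul_smul_comm, mul_one, one_mul, h.mul_EF, h.mul_WE, h.mul_WF, h.mul_NE,
    h.mul_NF, h.commute_NW.eq, hyF, hWy, hNy, mul_mul_of_mul_eq_smul_add h.mul_EF,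
    mul_mul_of_mul_eq_smul h.mul_NE, mul_mul_of_mul_eq_smul h.mul_NF,
    mul_mul_of_mul_eq_smul h.mul_WE, mul_mul_of_mul_eq_smul h.mul_WF,
    mul_mul_of_mul_eq_smul hNy, mul_mul_of_mul_eq_smul hyF, mul_mul_of_mul_eq_smul hWy]
  match_scalars <;> field_simp <;> ring

theorem quartic_cartan (h : IsCoactionTriple s k E F W N) (hs : s ≠ 0)
    (hyE : y * E = s⁻¹ ^ 2 • (E * y)) (hyF : y * F = s ^ 2 • (F * y)) (hyN : Commute y N)
    (hS : W ^ 3 * y - (s ^ 2 + 1 + (s ^ 2)⁻¹) • (W ^ 2 * y * W)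
      + (s ^ 2 + 1 + (s ^ 2)⁻¹) • (W * y * W ^ 2) - y * W ^ 3
      = (k * (s - s⁻¹) * (s + s⁻¹) ^ 2) • (N * (W * y - y * W))) :
    (E + F + W) ^ 3 * y - (s ^ 2 + 1 + (s ^ 2)⁻¹) • ((E + F + W) ^ 2 * y * (E + F + W))
      + (s ^ 2 + 1 + (s ^ 2)⁻¹) • ((E + F + W) * y * (E + F + W) ^ 2) - y * (E + F + W) ^ 3
      = (k * (s - s⁻¹) * (s + s⁻¹) ^ 2) • ((E + F + W) * y - y * (E + F + W)) := by
  rw [← sub_eq_zero, ← sub_eq_zero.mpr hS]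
  simp only [pow_succ (_ : R), pow_zero (_ : R), mul_add, add_mul, mul_sub, sub_mul, mul_assoc,
    smul_mul_assoc, mul_smul_comm, mul_one, one_mul, h.mul_EF, h.mul_WE, h.mul_WF, h.mul_NE,
    h.mul_NF, hyE, hyF, hyN.eq, mul_mul_of_mul_eq_smul_add h.mul_EF,
    mul_mul_of_commute h.commute_NW.symm, mul_mul_of_commute hyN,
    mul_mul_of_mul_eq_smul h.mul_NE, mul_mul_of_mul_eq_smul h.mul_NF,
    mul_mul_of_mul_eq_smul h.mul_WE, mul_mul_of_mul_eq_smul h.mul_WF,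
    mul_mul_of_mul_eq_smul hyE, mul_mul_of_mul_eq_smul hyF]
  match_scalars <;> field_simp <;> ring

/-- The relations of a single node of `U_q` make its coaction image a coaction triple. -/
theorem of_node (hs : s ≠ 0) {e f K a : R} (c d : ℂ)
    (hKe : K * e = s • (e * K)) (hKf : K * f = s⁻¹ • (f * K))
    (hef : (e * f - f * e) * K ^ 2 = (s - s⁻¹)⁻¹ • (K ^ 4 - 1))
    (hae : Commute a e) (haf : Commute a f) (haK : Commute a K) :
    IsCoactionTriple s (c * d * (s - s⁻¹)⁻¹) (c • (e * K)) (d • (f * K)) (K ^ 2 * a) (K ^ 4) where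
  mul_EF := by
    rw [← mul_assoc s⁻¹, mul_smul _ (s - s⁻¹)⁻¹, ← hef]
    simp only [pow_two (_ : R), sub_mul, mul_assoc, smul_mul_assoc, mul_smul_comm,
      mul_mul_of_mul_eq_smul hKe, mul_mul_of_mul_eq_smul hKf]
    match_scalars <;> field_simp
    ring
  mul_WE := by
    simp only [pow_two (_ : R), mul_assoc, smul_mul_assoc, mul_smul_comm, haK.eq,
      mul_mul_of_commute hae, mul_mul_of_mul_eq_smul hKe]
    module
  mul_WF := by
    simp only [pow_two (_ : R), mul_assoc, smul_mul_assoc, mul_smul_comm, haK.eq,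
      mul_mul_of_commute haf, mul_mul_of_mul_eq_smul hKf]
    module
  mul_NE := by
    simp only [pow_succ (_ : R), pow_zero (_ : R), one_mul, mul_assoc, smul_mul_assoc,
      mul_smul_comm, mul_mul_of_mul_eq_smul hKe]
    module
  mul_NF := by
    simp only [pow_succ (_ : R), pow_zero (_ : R), one_mul, mul_assoc, smul_mul_assoc,
      mul_smul_comm, mul_mul_of_mul_eq_smul hKf]
    module
  commute_NW := (Commute.pow_pow_self K 4 2).mul_right (haK.symm.pow_left 4)

end IsCoactionTriple

/-- The cubic q-Serre relation passes from `e₁, e₂` to multiples of `e₁K₁, e₂K₂`. -/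
theorem cubic_serre_mul_cartan {s t : ℂ} {e₁ e₂ K₁ K₂ : R} (c d : ℂ)
    (hK : Commute K₁ K₂) (h₁₁ : K₁ * e₁ = t ^ 2 • (e₁ * K₁))
    (h₁₂ : K₁ * e₂ = t⁻¹ • (e₂ * K₁)) (h₂₁ : K₂ * e₁ = t⁻¹ • (e₁ * K₂)) (ht : t ≠ 0)
    (hS : e₁ ^ 2 * e₂ - s • (e₁ * e₂ * e₁) + e₂ * e₁ ^ 2 = 0) :
    (c • (e₁ * K₁)) ^ 2 * (d • (e₂ * K₂)) - s • ((c • (e₁ * K₁)) * (d • (e₂ * K₂)) *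
      (c • (e₁ * K₁))) + (d • (e₂ * K₂)) * (c • (e₁ * K₁)) ^ 2 = 0 := by
  have key := congrArg (fun x => (c ^ 2 * d) • (x * (K₁ * (K₁ * K₂)))) hS
  simp only [zero_mul, smul_zero] at key
  rw [← key]
  simp only [pow_two (_ : R), add_mul, sub_mul, mul_assoc, smul_mul_assoc, mul_smul_comm,
    hK.symm.eq, mul_mul_of_commute hK.symm, mul_mul_of_mul_eq_smul h₁₁,
    mul_mul_of_mul_eq_smul h₁₂, mul_mul_of_mul_eq_smul h₂₁]
  match_scalars <;> field_simp

/-- The quartic q-Serre relation passes from `e₂, e₁` to multiples of `e₂K₂, e₁K₁`. -/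
theorem quartic_serre_mul_cartan {s t : ℂ} {e₁ e₂ K₁ K₂ : R} (c d : ℂ)
    (hK : Commute K₁ K₂) (h₂₂ : K₂ * e₂ = t • (e₂ * K₂))
    (h₁₂ : K₁ * e₂ = t⁻¹ • (e₂ * K₁)) (h₂₁ : K₂ * e₁ = t⁻¹ • (e₁ * K₂)) (ht : t ≠ 0)
    (hS : e₂ ^ 3 * e₁ - s • (e₂ ^ 2 * e₁ * e₂) + s • (e₂ * e₁ * e₂ ^ 2) - e₁ * e₂ ^ 3 = 0) :
    (d • (e₂ * K₂)) ^ 3 * (c • (e₁ * K₁))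
      - s • ((d • (e₂ * K₂)) ^ 2 * (c • (e₁ * K₁)) * (d • (e₂ * K₂)))
      + s • ((d • (e₂ * K₂)) * (c • (e₁ * K₁)) * (d • (e₂ * K₂)) ^ 2)
      - (c • (e₁ * K₁)) * (d • (e₂ * K₂)) ^ 3 = 0 := by
  have key := congrArg (fun x => (c * d ^ 3) • (x * (K₁ * (K₂ * (K₂ * K₂))))) hS
  simp only [zero_mul, smul_zero] at key
  rw [← key]
  simp only [pow_succ (_ : R), pow_zero (_ : R), one_mul, add_mul, sub_mul, mul_assoc,
    smul_mul_assoc, mul_smul_comm, hK.symm.eq, mul_mul_of_commute hK.symm,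
    mul_mul_of_mul_eq_smul h₂₂, mul_mul_of_mul_eq_smul h₁₂, mul_mul_of_mul_eq_smul h₂₁]
  match_scalars <;> field_simp

/-- Moving a `q`-commuting element past `K² a`, with `a` commuting with both. -/
theorem sq_mul_mul_smul {K L a e : R} {t : ℂ} (c : ℂ) (hKe : K * e = t • (e * K))
    (hae : Commute a e) (haL : Commute a L) (hK : Commute K L) :
    (K ^ 2 * a) * (c • (e * L)) = t ^ 2 • ((c • (e * L)) * (K ^ 2 * a)) := by
  simp only [pow_two (_ : R), mul_assoc, smul_mul_assoc, mul_smul_comm, haL.eq,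
    mul_mul_of_commute hae, mul_mul_of_mul_eq_smul hKe, mul_mul_of_commute hK]
  module

theorem pow_four_mul_smul {K L e : R} {t : ℂ} (c : ℂ) (hKe : K * e = t • (e * K))
    (hK : Commute K L) :
    K ^ 4 * (c • (e * L)) = t ^ 4 • ((c • (e * L)) * K ^ 4) := by
  have h := sq_mul_mul_smul c hKe (Commute.one_left e) (Commute.one_left L) hK
  rw [mul_one] at h
  rw [show K ^ 4 = K ^ 2 * K ^ 2 by rw [← pow_add], mul_assoc, h, mul_smul_comm, ← mul_assoc, h]
  simp only [smul_mul_assoc, mul_assoc, smul_smul]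
  ring_nf

theorem smul_mul_smul_of_cross {e f K L : R} {t : ℂ} (ht : t ≠ 0) (c d : ℂ)
    (hef : Commute e f) (hKf : K * f = t • (f * K)) (hLe : L * e = t⁻¹ • (e * L))
    (hK : Commute K L) :
    (c • (e * K)) * (d • (f * L)) = t ^ 2 • ((d • (f * L)) * (c • (e * K))) := by
  simp only [mul_assoc, smul_mul_assoc, mul_smul_comm, mul_mul_of_mul_eq_smul hKf,
    mul_mul_of_mul_eq_smul hLe, mul_mul_of_commute hef, hK.eq]
  match_scalars
  field_simp

theorem cubic_cartan_part {s ρ : ℂ} {K₁ K₂ a₁ a₂ : R} (hK : Commute K₁ K₂)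
    (h₁₁ : Commute a₁ K₁) (h₁₂ : Commute a₁ K₂) (h₂₁ : Commute a₂ K₁)
    (hO : a₁ ^ 2 * a₂ - s • (a₁ * a₂ * a₁) + a₂ * a₁ ^ 2 = ρ • a₂) :
    (K₁ ^ 2 * a₁) ^ 2 * (K₂ ^ 2 * a₂) - s • ((K₁ ^ 2 * a₁) * (K₂ ^ 2 * a₂) * (K₁ ^ 2 * a₁))
      + (K₂ ^ 2 * a₂) * (K₁ ^ 2 * a₁) ^ 2 = ρ • (K₁ ^ 4 * (K₂ ^ 2 * a₂)) := by
  have key := congrArg (fun x => K₁ ^ 4 * (K₂ ^ 2 * x)) hO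
  simp only [mul_smul_comm] at key
  rw [← key]
  simp only [pow_succ (_ : R), pow_zero (_ : R), one_mul, mul_add, mul_sub, mul_assoc,
    mul_smul_comm, mul_mul_of_commute h₁₁, mul_mul_of_commute h₁₂, mul_mul_of_commute h₂₁,
    mul_mul_of_commute hK.symm]

theorem quartic_cartan_part {s ρ : ℂ} {K₁ K₂ a₁ a₂ : R} (hK : Commute K₁ K₂)
    (h₁₂ : Commute a₁ K₂) (h₂₁ : Commute a₂ K₁) (h₂₂ : Commute a₂ K₂)
    (hO : a₂ ^ 3 * a₁ - s • (a₂ ^ 2 * a₁ * a₂) + s • (a₂ * a₁ * a₂ ^ 2) - a₁ * a₂ ^ 3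
      = ρ • (a₂ * a₁ - a₁ * a₂)) :
    (K₂ ^ 2 * a₂) ^ 3 * (K₁ ^ 2 * a₁) - s • ((K₂ ^ 2 * a₂) ^ 2 * (K₁ ^ 2 * a₁) * (K₂ ^ 2 * a₂))
      + s • ((K₂ ^ 2 * a₂) * (K₁ ^ 2 * a₁) * (K₂ ^ 2 * a₂) ^ 2)
      - (K₁ ^ 2 * a₁) * (K₂ ^ 2 * a₂) ^ 3
      = ρ • (K₂ ^ 4 * ((K₂ ^ 2 * a₂) * (K₁ ^ 2 * a₁) - (K₁ ^ 2 * a₁) * (K₂ ^ 2 * a₂))) := by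
  have key := congrArg (fun x => K₁ ^ 2 * (K₂ ^ 6 * x)) hO
  simp only [pow_succ (_ : R), pow_zero (_ : R), one_mul, mul_add, mul_sub, mul_assoc,
    mul_smul_comm, mul_mul_of_commute h₁₂, mul_mul_of_commute h₂₁, mul_mul_of_commute h₂₂,
    mul_mul_of_commute hK.symm] at key ⊢
  exact key

/-- The coaction images in terms of commuting copies of `U_q` and of the q-Onsager algebra inside
one algebra; invertibility of `K₁, K₂` enters only through `hef₁, hef₂`. -/
theorem coaction_relations {q : ℂ} (hq : q ≠ 0) (hq₁ : q ^ 2 - (q ^ 2)⁻¹ ≠ 0)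
    (hq₂ : q - q⁻¹ ≠ 0) {e₁ e₂ f₁ f₂ K₁ K₂ a₁ a₂ : R} (hK : Commute K₁ K₂)
    (hKe₁₁ : K₁ * e₁ = q ^ 2 • (e₁ * K₁)) (hKf₁₁ : K₁ * f₁ = (q ^ 2)⁻¹ • (f₁ * K₁))
    (hKe₂₂ : K₂ * e₂ = q • (e₂ * K₂)) (hKf₂₂ : K₂ * f₂ = q⁻¹ • (f₂ * K₂))
    (hKe₁₂ : K₁ * e₂ = q⁻¹ • (e₂ * K₁)) (hKf₁₂ : K₁ * f₂ = q • (f₂ * K₁))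
    (hKe₂₁ : K₂ * e₁ = q⁻¹ • (e₁ * K₂)) (hKf₂₁ : K₂ * f₁ = q • (f₁ * K₂))
    (hef₁ : (e₁ * f₁ - f₁ * e₁) * K₁ ^ 2 = (q ^ 2 - (q ^ 2)⁻¹)⁻¹ • (K₁ ^ 4 - 1))
    (hef₂ : (e₂ * f₂ - f₂ * e₂) * K₂ ^ 2 = (q - q⁻¹)⁻¹ • (K₂ ^ 4 - 1))
    (hef₁₂ : Commute e₁ f₂) (hef₂₁ : Commute e₂ f₁)
    (hSe₁₂ : e₁ ^ 2 * e₂ - (q ^ 2 + (q ^ 2)⁻¹) • (e₁ * e₂ * e₁) + e₂ * e₁ ^ 2 = 0)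
    (hSf₁₂ : f₁ ^ 2 * f₂ - (q ^ 2 + (q ^ 2)⁻¹) • (f₁ * f₂ * f₁) + f₂ * f₁ ^ 2 = 0)
    (hSe₂₁ : e₂ ^ 3 * e₁ - (q ^ 2 + 1 + (q ^ 2)⁻¹) • (e₂ ^ 2 * e₁ * e₂)
      + (q ^ 2 + 1 + (q ^ 2)⁻¹) • (e₂ * e₁ * e₂ ^ 2) - e₁ * e₂ ^ 3 = 0)
    (hSf₂₁ : f₂ ^ 3 * f₁ - (q ^ 2 + 1 + (q ^ 2)⁻¹) • (f₂ ^ 2 * f₁ * f₂)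
      + (q ^ 2 + 1 + (q ^ 2)⁻¹) • (f₂ * f₁ * f₂ ^ 2) - f₁ * f₂ ^ 3 = 0)
    (c₁ c₂ d₁ d₂ : ℂ)
    (ha₁ : ∀ x ∈ ({e₁, e₂, f₁, f₂, K₁, K₂} : Set R), Commute a₁ x)
    (ha₂ : ∀ x ∈ ({e₁, e₂, f₁, f₂, K₁, K₂} : Set R), Commute a₂ x)
    (hO₁₂ : a₁ ^ 2 * a₂ - (q ^ 2 + (q ^ 2)⁻¹) • (a₁ * a₂ * a₁) + a₂ * a₁ ^ 2
      = (c₁ * d₁) • a₂)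
    (hO₂₁ : a₂ ^ 3 * a₁ - (q ^ 2 + 1 + (q ^ 2)⁻¹) • (a₂ ^ 2 * a₁ * a₂)
        + (q ^ 2 + 1 + (q ^ 2)⁻¹) • (a₂ * a₁ * a₂ ^ 2) - a₁ * a₂ ^ 3
      = (c₂ * d₂ * (q + q⁻¹) ^ 2) • (a₂ * a₁ - a₁ * a₂))
    {D₁ D₂ : R} (hD₁ : D₁ = c₁ • (e₁ * K₁) + d₁ • (f₁ * K₁) + K₁ ^ 2 * a₁)
    (hD₂ : D₂ = c₂ • (e₂ * K₂) + d₂ • (f₂ * K₂) + K₂ ^ 2 * a₂) :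
    D₁ ^ 2 * D₂ - (q ^ 2 + (q ^ 2)⁻¹) • (D₁ * D₂ * D₁) + D₂ * D₁ ^ 2 = (c₁ * d₁) • D₂
    ∧ D₂ ^ 3 * D₁ - (q ^ 2 + 1 + (q ^ 2)⁻¹) • (D₂ ^ 2 * D₁ * D₂)
        + (q ^ 2 + 1 + (q ^ 2)⁻¹) • (D₂ * D₁ * D₂ ^ 2) - D₁ * D₂ ^ 3
      = (c₂ * d₂ * (q + q⁻¹) ^ 2) • (D₂ * D₁ - D₁ * D₂) := by
  simp only [Set.mem_insert_iff, Set.mem_singleton_iff, forall_eq_or_imp, forall_eq] at ha₁ ha₂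
  obtain ⟨h1e1, h1e2, h1f1, h1f2, h1K1, h1K2⟩ := ha₁
  obtain ⟨h2e1, h2e2, h2f1, h2f2, h2K1, h2K2⟩ := ha₂
  have hq' : q⁻¹ ≠ 0 := inv_ne_zero hq
  have hqq : q ^ 2 ≠ 0 := pow_ne_zero 2 hq
  have T₁ := IsCoactionTriple.of_node hqq c₁ d₁ hKe₁₁ hKf₁₁ hef₁ h1e1 h1f1 h1K1
  have T₂ := IsCoactionTriple.of_node hq c₂ d₂ hKe₂₂ hKf₂₂ hef₂ h2e2 h2f2 h2K2
  have k₁ : c₁ * d₁ * (q ^ 2 - (q ^ 2)⁻¹)⁻¹ * (q ^ 2 - (q ^ 2)⁻¹) = c₁ * d₁ :=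
    inv_mul_cancel_right₀ hq₁ _
  have k₂ : c₂ * d₂ * (q - q⁻¹)⁻¹ * (q - q⁻¹) = c₂ * d₂ := inv_mul_cancel_right₀ hq₂ _
  have hEF := smul_mul_smul_of_cross hq c₁ d₂ hef₁₂ hKf₁₂ hKe₂₁ hK
  have hFE := smul_mul_smul_of_cross hq' d₁ c₂ hef₂₁.symm hKe₁₂ (by rwa [inv_inv]) hK
  have hEF' := smul_mul_smul_of_cross hq c₂ d₁ hef₂₁ hKf₂₁ hKe₁₂ hK.symm
  have hFE' := smul_mul_smul_of_cross hq' d₂ c₁ hef₁₂.symm hKe₂₁ (by rwa [inv_inv]) hK.symm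
  have hWE₁₂ := sq_mul_mul_smul c₂ hKe₁₂ h1e2 h1K2 hK
  have hWF₁₂ := sq_mul_mul_smul d₂ hKf₁₂ h1f2 h1K2 hK
  have hWE₂₁ := sq_mul_mul_smul c₁ hKe₂₁ h2e1 h2K1 hK.symm
  have hWF₂₁ := sq_mul_mul_smul d₁ hKf₂₁ h2f1 h2K1 hK.symm
  have hNE₁₂ := pow_four_mul_smul c₂ hKe₁₂ hK
  have hNF₁₂ := pow_four_mul_smul d₂ hKf₁₂ hK
  have hNE₂₁ := pow_four_mul_smul c₁ hKe₂₁ hK.symm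
  have hNF₂₁ := pow_four_mul_smul d₁ hKf₂₁ hK.symm
  have hWN₂₁ : Commute (K₂ ^ 2 * a₂) (K₁ ^ 4) := (hK.symm.pow_pow 2 4).mul_left (h2K1.pow_right 4)
  have hWN₁₂ : Commute (K₁ ^ 2 * a₁) (K₂ ^ 4) := (hK.pow_pow 2 4).mul_left (h1K2.pow_right 4)
  have hSE₁ := cubic_serre_mul_cartan c₁ c₂ hK hKe₁₁ hKe₁₂ hKe₂₁ hq hSe₁₂
  have hSF₁ := cubic_serre_mul_cartan d₁ d₂ hK (t := q⁻¹) (by rwa [inv_pow]) (by rwa [inv_inv])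
    (by rwa [inv_inv]) hq' hSf₁₂
  have hSE₂ := quartic_serre_mul_cartan c₁ c₂ hK hKe₂₂ hKe₁₂ hKe₂₁ hq hSe₂₁
  have hSF₂ := quartic_serre_mul_cartan d₁ d₂ hK hKf₂₂ (by rwa [inv_inv]) (by rwa [inv_inv])
    hq' hSf₂₁
  have hSW₁ := cubic_cartan_part hK h1K1 h1K2 h2K1 hO₁₂
  have hSW₂ := quartic_cartan_part hK h1K2 h2K1 h2K2 hO₂₁
  rw [← k₁] at hSW₁ ⊢
  rw [← k₂] at hSW₂ ⊢
  have hN₁ : ((q ^ 2)⁻¹) ^ 2 = q⁻¹ ^ 4 := by rw [← inv_pow, ← pow_mul]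
  have hN₁' : (q ^ 2) ^ 2 = q ^ 4 := by rw [← pow_mul]
  have hp : q ^ 2 + (q ^ 2)⁻¹ = (q ^ 2)⁻¹ + ((q ^ 2)⁻¹)⁻¹ := by rw [inv_inv, add_comm]
  have hp' : q ^ 2 + 1 + (q ^ 2)⁻¹ = q⁻¹ ^ 2 + 1 + (q⁻¹ ^ 2)⁻¹ := by
    rw [inv_pow, inv_inv]; ring
  have cE := T₁.cubic_root hqq (y := c₂ • (e₂ * K₂)) hEF' (by rwa [← inv_pow])
    (by rwa [hN₁]) hSE₁
  have cF := (T₁.symm hqq).cubic_root (inv_ne_zero hqq) (y := d₂ • (f₂ * K₂))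
    (by rwa [← inv_pow]) (by rwa [inv_inv]) (by rwa [inv_inv, hN₁']) (by rwa [← hp])
  have cW := T₁.cubic_cartan hqq (by rwa [← inv_pow]) hWF₂₁ hWN₂₁ hSW₁
  have qE := T₂.quartic_root hq (y := c₁ • (e₁ * K₁)) hEF hWE₂₁ hNE₂₁ hSE₂
  have qF := (T₂.symm hq).quartic_root hq' (y := d₁ • (f₁ * K₁)) hFE (by rwa [inv_inv])
    (by rwa [inv_inv]) (by rwa [← hp'])
  have qW := T₂.quartic_cartan hq hWE₁₂ hWF₁₂ hWN₁₂ hSW₂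
  rw [← hp, add_comm (d₁ • (f₁ * K₁)), inv_inv, neg_mul, ← mul_neg, neg_sub] at cF
  rw [← hp', add_comm (d₂ • (f₂ * K₂)), inv_inv, neg_mul, ← mul_neg, neg_sub,
    add_comm q⁻¹ q] at qF
  rw [← hD₁] at cE cF cW
  rw [← hD₂] at qE qF qW
  constructor
  · conv_rhs => rw [hD₂, smul_add, smul_add, ← cE, ← cF, ← cW]
    rw [hD₂]
    simp only [mul_add, add_mul, smul_add]
    abel
  · have hsplit (x y z : R) : D₂ * (x + y + z) - (x + y + z) * D₂
        = (D₂ * x - x * D₂) + (D₂ * y - y * D₂) + (D₂ * z - z * D₂) := by noncomm_ring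
    rw [hD₁, hsplit, smul_add, smul_add, ← qE, ← qF, ← qW]
    simp only [mul_add, add_mul, smul_add]
    abel

end QOnsager

/-- If `𝒜₁, 𝒜₂` satisfy the doubly-linked generalized q-Onsager
relations, then the images `D_i = (c_i e_i K_i + c̄_i f_i K_i) ⊗ 1 + K_i² ⊗ 𝒜_i`
under the coaction map satisfy the same two relations in `A ⊗[ℂ] B`. -/
theorem stmt_9 (q : ℂ) (hq0 : q ≠ 0) (hqroot : ∀ n : ℕ, 0 < n → q ^ n ≠ 1)
    (A : Type*) [Ring A] [Algebra ℂ A]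
    (e₁ e₂ f₁ f₂ : A) (K₁ K₂ : Aˣ)
    (hKcomm : (K₁ : A) * (K₂ : A) = (K₂ : A) * (K₁ : A))
    (hK1e1 : (K₁ : A) * e₁ * ((K₁⁻¹ : Aˣ) : A) = (q ^ 2) • e₁)
    (hK1f1 : (K₁ : A) * f₁ * ((K₁⁻¹ : Aˣ) : A) = (q ^ 2)⁻¹ • f₁)
    (hK2e2 : (K₂ : A) * e₂ * ((K₂⁻¹ : Aˣ) : A) = q • e₂)
    (hK2f2 : (K₂ : A) * f₂ * ((K₂⁻¹ : Aˣ) : A) = q⁻¹ • f₂)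
    (hK1e2 : (K₁ : A) * e₂ * ((K₁⁻¹ : Aˣ) : A) = q⁻¹ • e₂)
    (hK1f2 : (K₁ : A) * f₂ * ((K₁⁻¹ : Aˣ) : A) = q • f₂)
    (hK2e1 : (K₂ : A) * e₁ * ((K₂⁻¹ : Aˣ) : A) = q⁻¹ • e₁)
    (hK2f1 : (K₂ : A) * f₁ * ((K₂⁻¹ : Aˣ) : A) = q • f₁)
    (hef1 : e₁ * f₁ - f₁ * e₁
      = (q ^ 2 - (q ^ 2)⁻¹)⁻¹ • ((K₁ : A) ^ 2 - ((K₁⁻¹ : Aˣ) : A) ^ 2))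
    (hef2 : e₂ * f₂ - f₂ * e₂
      = (q - q⁻¹)⁻¹ • ((K₂ : A) ^ 2 - ((K₂⁻¹ : Aˣ) : A) ^ 2))
    (hef12 : e₁ * f₂ = f₂ * e₁) (hef21 : e₂ * f₁ = f₁ * e₂)
    (hSe12 : e₁ ^ 2 * e₂ - (q ^ 2 + (q ^ 2)⁻¹) • (e₁ * e₂ * e₁) + e₂ * e₁ ^ 2 = 0)
    (hSf12 : f₁ ^ 2 * f₂ - (q ^ 2 + (q ^ 2)⁻¹) • (f₁ * f₂ * f₁) + f₂ * f₁ ^ 2 = 0)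
    (hSe21 : e₂ ^ 3 * e₁ - (q ^ 2 + 1 + (q ^ 2)⁻¹) • (e₂ ^ 2 * e₁ * e₂)
      + (q ^ 2 + 1 + (q ^ 2)⁻¹) • (e₂ * e₁ * e₂ ^ 2) - e₁ * e₂ ^ 3 = 0)
    (hSf21 : f₂ ^ 3 * f₁ - (q ^ 2 + 1 + (q ^ 2)⁻¹) • (f₂ ^ 2 * f₁ * f₂)
      + (q ^ 2 + 1 + (q ^ 2)⁻¹) • (f₂ * f₁ * f₂ ^ 2) - f₁ * f₂ ^ 3 = 0)
    (B : Type*) [Ring B] [Algebra ℂ B]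
    (c₁ c₂ cb₁ cb₂ : ℂ) (𝒜₁ 𝒜₂ : B)
    (hOns12 : 𝒜₁ ^ 2 * 𝒜₂ - (q ^ 2 + (q ^ 2)⁻¹) • (𝒜₁ * 𝒜₂ * 𝒜₁) + 𝒜₂ * 𝒜₁ ^ 2
      = (c₁ * cb₁) • 𝒜₂)
    (hOns21 : 𝒜₂ ^ 3 * 𝒜₁ - (q ^ 2 + 1 + (q ^ 2)⁻¹) • (𝒜₂ ^ 2 * 𝒜₁ * 𝒜₂)
        + (q ^ 2 + 1 + (q ^ 2)⁻¹) • (𝒜₂ * 𝒜₁ * 𝒜₂ ^ 2) - 𝒜₁ * 𝒜₂ ^ 3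
      = (c₂ * cb₂ * (q + q⁻¹) ^ 2) • (𝒜₂ * 𝒜₁ - 𝒜₁ * 𝒜₂))
    (D₁ D₂ : A ⊗[ℂ] B)
    (hD1 : D₁ = (c₁ • (e₁ * (K₁ : A)) + cb₁ • (f₁ * (K₁ : A))) ⊗ₜ[ℂ] (1 : B)
      + ((K₁ : A) ^ 2) ⊗ₜ[ℂ] 𝒜₁)
    (hD2 : D₂ = (c₂ • (e₂ * (K₂ : A)) + cb₂ • (f₂ * (K₂ : A))) ⊗ₜ[ℂ] (1 : B)
      + ((K₂ : A) ^ 2) ⊗ₜ[ℂ] 𝒜₂) :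
    D₁ ^ 2 * D₂ - (q ^ 2 + (q ^ 2)⁻¹) • (D₁ * D₂ * D₁) + D₂ * D₁ ^ 2 = (c₁ * cb₁) • D₂
    ∧ D₂ ^ 3 * D₁ - (q ^ 2 + 1 + (q ^ 2)⁻¹) • (D₂ ^ 2 * D₁ * D₂)
        + (q ^ 2 + 1 + (q ^ 2)⁻¹) • (D₂ * D₁ * D₂ ^ 2) - D₁ * D₂ ^ 3
      = (c₂ * cb₂ * (q + q⁻¹) ^ 2) • (D₂ * D₁ - D₁ * D₂) := by
  have mul_eq {K : Aˣ} {x : A} {t : ℂ} (h : (K : A) * x * ((K⁻¹ : Aˣ) : A) = t • x) :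
      (K : A) * x = t • (x * K) := by
    rw [← smul_mul_assoc, ← h, Units.inv_mul_cancel_right]
  have cancel {K : Aˣ} {x : A} {t : ℂ} (h : x = t • ((K : A) ^ 2 - ((K⁻¹ : Aˣ) : A) ^ 2)) :
      x * (K : A) ^ 2 = t • ((K : A) ^ 4 - 1) := by
    have hinv : ((K⁻¹ : Aˣ) : A) ^ 2 * (K : A) ^ 2 = 1 := by
      rw [pow_two, pow_two, mul_assoc, Units.inv_mul_cancel_left, Units.inv_mul]
    rw [h, smul_mul_assoc, sub_mul, ← pow_add, hinv]
  have hq₂ : q - q⁻¹ ≠ 0 := fun h => hqroot 2 two_pos <| by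
    field_simp at h
    linear_combination h
  have hq₁ : q ^ 2 - (q ^ 2)⁻¹ ≠ 0 := fun h => hqroot 4 four_pos <| by
    field_simp at h
    linear_combination h
  let φ : A →ₐ[ℂ] A ⊗[ℂ] B := Algebra.TensorProduct.includeLeft
  let ψ : B →ₐ[ℂ] A ⊗[ℂ] B := Algebra.TensorProduct.includeRight
  have hφψ (x : A) (b : B) : φ x * ψ b = x ⊗ₜ b := by simp [φ, ψ]
  have hcomm (b : B) (x : A) : Commute (ψ b) (φ x) := by simp [φ, ψ, commute_iff_eq]
  refine coaction_relations (e₁ := φ e₁) (e₂ := φ e₂) (f₁ := φ f₁) (f₂ := φ f₂) (K₁ := φ K₁)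
    (K₂ := φ K₂) (a₁ := ψ 𝒜₁) (a₂ := ψ 𝒜₂) hq0 hq₁ hq₂ (Commute.map hKcomm φ)
    ?_ ?_ ?_ ?_ ?_ ?_ ?_ ?_ ?_ ?_ (Commute.map hef12 φ) (Commute.map hef21 φ) ?_ ?_ ?_ ?_
    c₁ c₂ cb₁ cb₂ ?_ ?_ ?_ ?_ ?_ ?_
  · simpa using congrArg φ (mul_eq hK1e1)
  · simpa using congrArg φ (mul_eq hK1f1)
  · simpa using congrArg φ (mul_eq hK2e2)
  · simpa using congrArg φ (mul_eq hK2f2)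
  · simpa using congrArg φ (mul_eq hK1e2)
  · simpa using congrArg φ (mul_eq hK1f2)
  · simpa using congrArg φ (mul_eq hK2e1)
  · simpa using congrArg φ (mul_eq hK2f1)
  · simpa only [map_mul, map_sub, map_smul, map_pow, map_one] using congrArg φ (cancel hef1)
  · simpa only [map_mul, map_sub, map_smul, map_pow, map_one] using congrArg φ (cancel hef2)
  · simpa only [map_mul, map_sub, map_add, map_smul, map_pow, map_zero] using congrArg φ hSe12
  · simpa only [map_mul, map_sub, map_add, map_smul, map_pow, map_zero] using congrArg φ hSf12
  · simpa only [map_mul, map_sub, map_add, map_smul, map_pow, map_zero] using congrArg φ hSe21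
  · simpa only [map_mul, map_sub, map_add, map_smul, map_pow, map_zero] using congrArg φ hSf21
  · simp [hcomm]
  · simp [hcomm]
  · simpa only [map_mul, map_sub, map_add, map_smul, map_pow] using congrArg ψ hOns12
  · simpa only [map_mul, map_sub, map_add, map_smul, map_pow] using congrArg ψ hOns21
  · simp only [hD1, ← map_pow, ← map_mul, ← map_smul, ← map_add, hφψ]
    rfl
  · simp only [hD2, ← map_pow, ← map_mul, ← map_smul, ← map_add, hφψ]
    rfl
end
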